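/- arXiv:1608.02286 — 2 statements merged into one kernel-verified Lean document; each statement's English description precedes it below -/
import Mathlib

section
/- Let L be an n×n real symmetric matrix whose kernel is exactly span(1), let λ̃ be an eigenvalue of L, set L̃ = L − λ̃ Iₙ, and assume the kernel of L̃ is exactly span(ṽ) for some nonzero vector ṽ ∈ ℝⁿ, and that every column l̃ⁱ of L̃ is nonzero. Let P = diag(P₁, …, Pₙ) be the n²×n² block-diagonal matrix with blocks Pᵢ = (l̃ⁱ (l̃ⁱ)ᵀ)/((l̃ⁱ)ᵀ l̃ⁱ). Then the intersection of the kernel of L ⊗ Iₙ and the kernel of P is exactly span(1 ⊗ ṽ). -/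
open Matrix Kronecker

/-- Kronecker product of two vectors. -/
def vKron {m n : ℕ} (v : Fin m → ℝ) (w : Fin n → ℝ) : Fin m × Fin n → ℝ :=
  fun p => v p.1 * w p.2

/-- Rank-one projection `(v vᵀ)/(vᵀ v)`. -/
noncomputable def proj {n : ℕ} (v : Fin n → ℝ) : Matrix (Fin n) (Fin n) ℝ :=
  (v ⬝ᵥ v)⁻¹ • Matrix.vecMulVec v v

/-- `n²×n²` block-diagonal matrix with blocks `P 1, …, P n`. -/
def bdiag {n : ℕ} (P : Fin n → Matrix (Fin n) (Fin n) ℝ) :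
    Matrix (Fin n × Fin n) (Fin n × Fin n) ℝ :=
  fun p q => if p.1 = q.1 then P p.1 p.2 q.2 else 0

theorem kronecker_one_mulVec_apply {n : ℕ} (L : Matrix (Fin n) (Fin n) ℝ)
    (x : Fin n × Fin n → ℝ) (i j : Fin n) :
    ((L ⊗ₖ (1 : Matrix (Fin n) (Fin n) ℝ)) *ᵥ x) (i, j) = (L *ᵥ fun k => x (k, j)) i := by
  simp [mulVec, dotProduct, Fintype.sum_prod_type, one_apply]

theorem bdiag_mulVec_apply {n : ℕ} (P : Fin n → Matrix (Fin n) (Fin n) ℝ)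
    (x : Fin n × Fin n → ℝ) (i j : Fin n) :
    (bdiag P *ᵥ x) (i, j) = (P i *ᵥ fun k => x (i, k)) j := by
  simp only [mulVec, dotProduct, bdiag, Fintype.sum_prod_type, ite_mul, zero_mul]
  rw [Finset.sum_comm]
  simp

theorem proj_mulVec_eq_zero_iff {n : ℕ} {v : Fin n → ℝ} (hv : v ≠ 0) (y : Fin n → ℝ) :
    proj v *ᵥ y = 0 ↔ v ⬝ᵥ y = 0 := by
  rw [proj, smul_mulVec, vecMulVec_mulVec]
  simp [hv]

theorem kronecker_one_mulVec_eq_zero_iff {n : ℕ} (L : Matrix (Fin n) (Fin n) ℝ)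
    (x : Fin n × Fin n → ℝ) :
    (L ⊗ₖ (1 : Matrix (Fin n) (Fin n) ℝ)) *ᵥ x = 0 ↔ ∀ j, (L *ᵥ fun k => x (k, j)) = 0 := by
  simp only [funext_iff, Prod.forall, kronecker_one_mulVec_apply, Pi.zero_apply]
  exact forall_comm

theorem bdiag_mulVec_eq_zero_iff {n : ℕ} (P : Fin n → Matrix (Fin n) (Fin n) ℝ)
    (x : Fin n × Fin n → ℝ) :
    bdiag P *ᵥ x = 0 ↔ ∀ i, (P i *ᵥ fun k => x (i, k)) = 0 := by
  simp only [funext_iff, Prod.forall, bdiag_mulVec_apply, Pi.zero_apply]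

/-- With `L` symmetric, `ker L = span(1)`, `λ̃` an eigenvalue of `L`,
`L̃ = L − λ̃ Iₙ` with `ker L̃ = span(ṽ)` and all columns `l̃ⁱ` of `L̃` nonzero, the
intersection of the kernels of `L ⊗ Iₙ` and `P = diag(P₁,…,Pₙ)` is `span(1 ⊗ ṽ)`. -/
theorem stmt8 (n : ℕ) (L : Matrix (Fin n) (Fin n) ℝ) (hsymm : L.IsSymm)
    (hkerL : ∀ x : Fin n → ℝ, L *ᵥ x = 0 ↔ ∃ c : ℝ, x = c • (fun _ => (1 : ℝ)))
    (lam : ℝ) (tv : Fin n → ℝ) (htv : tv ≠ 0)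
    (heig : L *ᵥ tv = lam • tv)
    (Lt : Matrix (Fin n) (Fin n) ℝ)
    (hLt : Lt = L - lam • (1 : Matrix (Fin n) (Fin n) ℝ))
    (hkerLt : ∀ x : Fin n → ℝ, Lt *ᵥ x = 0 ↔ ∃ c : ℝ, x = c • tv)
    (hcol : ∀ i, (fun j => Lt j i) ≠ 0)
    (P : Matrix (Fin n × Fin n) (Fin n × Fin n) ℝ)
    (hP : P = bdiag (fun i => proj (fun j => Lt j i))) :
    ∀ x : Fin n × Fin n → ℝ,
      ((L ⊗ₖ (1 : Matrix (Fin n) (Fin n) ℝ)) *ᵥ x = 0 ∧ P *ᵥ x = 0) ↔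
      ∃ c : ℝ, x = c • vKron (fun _ => (1 : ℝ)) tv := by
  intro x
  have hLt_symm : Lt.IsSymm := by
    rw [hLt]
    exact hsymm.sub (isSymm_one.smul lam)
  have hrow : ∀ i, (fun j => Lt j i) = Lt i := fun i => funext fun j => hLt_symm.apply i j
  have hPker : P *ᵥ x = 0 ↔ ∀ i, Lt i ⬝ᵥ (fun k => x (i, k)) = 0 := by
    rw [hP, bdiag_mulVec_eq_zero_iff]
    refine forall_congr' fun i => ?_
    rw [proj_mulVec_eq_zero_iff (hcol i), hrow]
  rw [kronecker_one_mulVec_eq_zero_iff, hPker]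
  constructor
  · rintro ⟨hLx, hPx⟩
    choose y hy using fun j => (hkerL _).1 (hLx j)
    have hxy : ∀ i j, x (i, j) = y j := fun i j => by simpa using congrFun (hy j) i
    simp only [hxy] at hPx
    obtain ⟨c, hc⟩ := (hkerLt y).1 (funext hPx)
    refine ⟨c, funext fun ⟨i, j⟩ => ?_⟩
    simp [hxy, hc, vKron]
  · rintro ⟨c, rfl⟩
    refine ⟨fun j => (hkerL _).2 ⟨c * tv j, funext fun i => by simp [vKron]⟩, fun i => ?_⟩
    have hker : Lt *ᵥ (c • tv) = 0 := (hkerLt _).2 ⟨c, rfl⟩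
    simpa [vKron, mulVec, Pi.smul_def] using congrFun hker i
end

section
/- Let L : ℝ → Matₙ(ℝ) be a differentiable matrix-valued function with L(s) symmetric for every s, and let v : ℝ → ℝⁿ be differentiable with v(s)ᵀ v(s) = 1 for all s and L(s) v(s) = λ(s) v(s) for a differentiable function λ : ℝ → ℝ. Then the derivative of the eigenvalue satisfies λ'(s) = v(s)ᵀ L'(s) v(s) for all s. -/
open Matrix

/-- Product rule for a matrix acting on a vector, with the matrix differentiated entrywise. -/
theorem hasDerivAt_mulVec {m n : Type*} [Fintype m] [Fintype n] {L : ℝ → Matrix m n ℝ}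
    {L' : Matrix m n ℝ} {v : ℝ → n → ℝ} {v' : n → ℝ} {s : ℝ}
    (hL : ∀ i j, HasDerivAt (fun t => L t i j) (L' i j) s) (hv : HasDerivAt v v' s) :
    HasDerivAt (fun t => L t *ᵥ v t) (L' *ᵥ v s + L s *ᵥ v') s := by
  rw [hasDerivAt_pi] at hv ⊢
  intro i
  simp only [Pi.add_apply, Matrix.mulVec, dotProduct, ← Finset.sum_add_distrib]
  exact HasDerivAt.fun_sum fun j _ => (hL i j).mul (hv j)

/-- For a differentiable family of symmetric matrices `L(s)` with a
differentiable unit eigenvector `v(s)` and differentiable eigenvalue `λ(s)`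
(`L(s) v(s) = λ(s) v(s)`, `v(s)ᵀ v(s) = 1`), the derivative of the eigenvalue
satisfies `λ'(s) = v(s)ᵀ L'(s) v(s)`. -/
theorem stmt15 (n : ℕ) (L : ℝ → Matrix (Fin n) (Fin n) ℝ)
    (L' : ℝ → Matrix (Fin n) (Fin n) ℝ)
    (hL' : ∀ (s : ℝ) (i j : Fin n), HasDerivAt (fun t => L t i j) (L' s i j) s)
    (hsymm : ∀ s, (L s).IsSymm)
    (v : ℝ → (Fin n → ℝ)) (v' : ℝ → (Fin n → ℝ))
    (hv' : ∀ s : ℝ, HasDerivAt v (v' s) s)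
    (hunit : ∀ s : ℝ, v s ⬝ᵥ v s = 1)
    (lam : ℝ → ℝ) (lam' : ℝ → ℝ)
    (hlam' : ∀ s : ℝ, HasDerivAt lam (lam' s) s)
    (heig : ∀ s : ℝ, L s *ᵥ v s = lam s • v s) :
    ∀ s : ℝ, lam' s = v s ⬝ᵥ (L' s *ᵥ v s) := by
  intro s
  have hprod := hasDerivAt_mulVec (hL' s) (hv' s)
  simp only [heig] at hprod
  have hderiv : L' s *ᵥ v s + L s *ᵥ v' s = lam s • v' s + lam' s • v s :=
    hprod.unique ((hlam' s).smul (hv' s))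
  have hself : v s ⬝ᵥ (L s *ᵥ v' s) = lam s * (v s ⬝ᵥ v' s) := by
    rw [dotProduct_mulVec, ← mulVec_transpose, (hsymm s).eq, heig, smul_dotProduct, smul_eq_mul]
  have hdot := congrArg (v s ⬝ᵥ ·) hderiv
  simp only [dotProduct_add, dotProduct_smul, smul_eq_mul, hunit, hself] at hdot
  linarith
end
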